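/- arXiv:2604.08949 — 2 statements merged into one kernel-verified Lean document; each statement's English description precedes it below -/
import Mathlib

section
/- Let C = {x_1, …, x_M} ⊂ ℝ^d be a finite set of distinct points, let x_i ∈ C, and let γ > 0. Write d_ij = ‖x_i − x_j‖ for j ≠ i. Then the probability of leaving the Voronoi cell of x_i satisfies the union bound ∫_{ℝ^d \ (V(x_i) − x_i)} f_γ(n) dn ≤ Σ_{j ≠ i} [ 1/2 − (1/π)·arctan( d_ij/(2γ) ) ]. -/
open MeasureTheory Real Filter
open scoped RealInnerProductSpace Topology

noncomputable def cC (d : ℕ) : ℝ :=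
  Real.Gamma (((d : ℝ) + 1) / 2) / Real.pi ^ (((d : ℝ) + 1) / 2)

noncomputable def fC (d : ℕ) (γ : ℝ) (n : EuclideanSpace ℝ (Fin d)) : ℝ :=
  cC d * γ ^ (-(d : ℝ)) * (1 + ‖n‖ ^ 2 / γ ^ 2) ^ (-(((d : ℝ) + 1) / 2))

/-- The Voronoi cell of `x` in the constellation `C`. -/
def vor {d : ℕ} (C : Set (EuclideanSpace ℝ (Fin d))) (x : EuclideanSpace ℝ (Fin d)) :
    Set (EuclideanSpace ℝ (Fin d)) := {y | ∀ c ∈ C, ‖y - x‖ ≤ ‖y - c‖}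

/-- The Voronoi cell of `x` translated by `-x`. -/
def vorT {d : ℕ} (C : Set (EuclideanSpace ℝ (Fin d))) (x : EuclideanSpace ℝ (Fin d)) :
    Set (EuclideanSpace ℝ (Fin d)) := (fun y => y - x) '' vor C x

/-- Conditional symbol error probability `P_e(x;γ)`. -/
noncomputable def Pe {d : ℕ} (C : Set (EuclideanSpace ℝ (Fin d)))
    (x : EuclideanSpace ℝ (Fin d)) (γ : ℝ) : ℝ :=
  ∫ n in (vorT C x)ᶜ, fC d γ n

theorem lintegral_gaussian_inner {k : ℕ} {u : EuclideanSpace ℝ (Fin (k + 1))} (hu : ‖u‖ = 1)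
    {b : ℝ} (hb : 0 < b) {g : ℝ → ENNReal} (hg : Measurable g) :
    ∫⁻ n : EuclideanSpace ℝ (Fin (k + 1)), g ⟪u, n⟫ * ENNReal.ofReal (exp (-b * ‖n‖ ^ 2))
      = ENNReal.ofReal ((π / b) ^ ((k : ℝ) / 2)) *
        ∫⁻ y, g y * ENNReal.ofReal (exp (-b * y ^ 2)) := by
  have horth : Orthonormal ℝ (({0} : Set (Fin (k + 1))).domRestrict fun _ => u) := by
    refine ⟨fun _ => hu, fun i j hij => absurd (Subsingleton.elim i j) hij⟩
  obtain ⟨B, hB⟩ := horth.exists_orthonormalBasis_extension_of_card_eq (by simp)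
  have hB0 : B 0 = u := hB 0 rfl
  let T : EuclideanSpace ℝ (Fin (k + 1)) → ℝ × (Fin k → ℝ) := fun n =>
    (WithLp.ofLp (B.repr n) 0, fun i => WithLp.ofLp (B.repr n) i.succ)
  have hmp : MeasurePreserving T volume (volume.prod volume) :=
    (volume_preserving_piFinSuccAbove (fun _ : Fin (k + 1) => ℝ) 0).comp
      ((PiLp.volume_preserving_ofLp _).comp B.measurePreserving_repr)
  let F : ℝ × (Fin k → ℝ) → ENNReal := fun p =>
    (g p.1 * ENNReal.ofReal (exp (-b * p.1 ^ 2))) * ENNReal.ofReal (exp (-b * ∑ i, p.2 i ^ 2))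
  have hgauss : ∫⁻ z : Fin k → ℝ, ENNReal.ofReal (exp (-b * ∑ i, z i ^ 2))
      = ENNReal.ofReal ((π / b) ^ ((k : ℝ) / 2)) := by
    have h1 := GaussianFourier.integral_rexp_neg_mul_sq_norm (V := EuclideanSpace ℝ (Fin k)) hb
    rw [finrank_euclideanSpace_fin] at h1
    rw [← h1, ofReal_integral_eq_lintegral_ofReal
      (not_imp_comm.1 integral_undef (by rw [h1]; positivity))
      (ae_of_all _ fun _ => (exp_pos _).le)]
    rw [← (PiLp.volume_preserving_ofLp (Fin k)).lintegral_comp (by fun_prop)]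
    simp [EuclideanSpace.real_norm_sq_eq]
  have hpt : ∀ n, g ⟪u, n⟫ * ENNReal.ofReal (exp (-b * ‖n‖ ^ 2)) = F (T n) := by
    intro n
    have h0 : WithLp.ofLp (B.repr n) 0 = ⟪u, n⟫ := by rw [B.repr_apply_apply, hB0]
    have hn : ‖n‖ ^ 2 = ⟪u, n⟫ ^ 2 + ∑ i : Fin k, WithLp.ofLp (B.repr n) i.succ ^ 2 := by
      rw [← B.repr.norm_map n, EuclideanSpace.real_norm_sq_eq, Fin.sum_univ_succ, h0]
    simp only [F, T, h0]
    rw [hn, mul_add, exp_add, ENNReal.ofReal_mul (exp_pos _).le, mul_assoc]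
  have hF : Measurable F := by fun_prop
  rw [lintegral_congr hpt, hmp.lintegral_comp hF]
  simp only [F]
  rw [lintegral_prod_mul (f := fun y => g y * ENNReal.ofReal (exp (-b * y ^ 2)))
    (g := fun z : Fin k → ℝ => ENNReal.ofReal (exp (-b * ∑ i, z i ^ 2)))
    (by fun_prop) (Measurable.aemeasurable (by fun_prop)), hgauss, mul_comm]

theorem lintegral_rpow_mul_exp_neg_mul_Ioi {a r : ℝ} (ha : 0 < a) (hr : 0 < r) :
    ∫⁻ s in Set.Ioi 0, ENNReal.ofReal (s ^ (a - 1) * exp (-(r * s)))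
      = ENNReal.ofReal ((1 / r) ^ a * Gamma a) := by
  have h := integral_rpow_mul_exp_neg_mul_Ioi ha hr
  have hG := Gamma_pos_of_pos ha
  rw [← h, ofReal_integral_eq_lintegral_ofReal
    (not_imp_comm.1 integral_undef (by rw [h]; positivity))]
  refine (ae_restrict_iff' measurableSet_Ioi).2 (ae_of_all _ fun s hs => ?_)
  have : 0 < s := hs
  simp only [Pi.zero_apply]
  positivity

theorem ofReal_fC_eq_lintegral {k : ℕ} {γ : ℝ} (hγ : 0 < γ) (n : EuclideanSpace ℝ (Fin (k + 1))) :
    ENNReal.ofReal (fC (k + 1) γ n) =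
      ENNReal.ofReal (π ^ (-((k : ℝ) / 2 + 1)) * γ ^ (-((k : ℝ) + 1))) *
      ∫⁻ s in Set.Ioi 0, ENNReal.ofReal (s ^ ((k : ℝ) / 2) * exp (-s)) *
        ENNReal.ofReal (exp (-(s / γ ^ 2) * ‖n‖ ^ 2)) := by
  have ha : (0 : ℝ) < (k : ℝ) / 2 + 1 := by positivity
  have hr : 0 < 1 + ‖n‖ ^ 2 / γ ^ 2 := by positivity
  have h := lintegral_rpow_mul_exp_neg_mul_Ioi ha hr
  have h2 : ∫⁻ s in Set.Ioi 0, ENNReal.ofReal (s ^ ((k : ℝ) / 2) * exp (-s)) *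
        ENNReal.ofReal (exp (-(s / γ ^ 2) * ‖n‖ ^ 2)) =
      ENNReal.ofReal ((1 / (1 + ‖n‖ ^ 2 / γ ^ 2)) ^ ((k : ℝ) / 2 + 1) * Gamma ((k : ℝ) / 2 + 1)) := by
    rw [← h]
    refine lintegral_congr fun s => ?_
    rw [← ENNReal.ofReal_mul' (exp_pos _).le, mul_assoc, ← exp_add, add_sub_cancel_right]
    ring_nf
  rw [h2, ← ENNReal.ofReal_mul (by positivity), fC, cC]
  have e : (((k + 1 : ℕ) : ℝ) + 1) / 2 = (k : ℝ) / 2 + 1 := by push_cast; ring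
  rw [e, one_div, inv_rpow hr.le, rpow_neg hr.le, rpow_neg pi_pos.le]
  push_cast
  ring_nf

theorem lintegral_fC_inner {k : ℕ} {γ : ℝ} (hγ : 0 < γ) {u : EuclideanSpace ℝ (Fin (k + 1))}
    (hu : ‖u‖ = 1) {g : ℝ → ENNReal} (hg : Measurable g) :
    ∫⁻ n, g ⟪u, n⟫ * ENNReal.ofReal (fC (k + 1) γ n)
      = ∫⁻ y, g y * ENNReal.ofReal ((π * γ)⁻¹ * (1 + y ^ 2 / γ ^ 2)⁻¹) := by
  set K := π ^ (-((k : ℝ) / 2 + 1)) * γ ^ (-((k : ℝ) + 1)) with hK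
  calc
    _ = ENNReal.ofReal K * ∫⁻ n : EuclideanSpace ℝ (Fin (k + 1)), ∫⁻ s in Set.Ioi 0,
          ENNReal.ofReal (s ^ ((k : ℝ) / 2) * exp (-s)) *
          (g ⟪u, n⟫ * ENNReal.ofReal (exp (-(s / γ ^ 2) * ‖n‖ ^ 2))) := by
      rw [← lintegral_const_mul' _ _ ENNReal.ofReal_ne_top]
      refine lintegral_congr fun n => ?_
      rw [ofReal_fC_eq_lintegral hγ, mul_left_comm, ← lintegral_const_mul _ (by fun_prop)]
      simp_rw [mul_left_comm, hK]
    _ = ENNReal.ofReal K * ∫⁻ s in Set.Ioi 0, ∫⁻ n : EuclideanSpace ℝ (Fin (k + 1)),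
          ENNReal.ofReal (s ^ ((k : ℝ) / 2) * exp (-s)) *
          (g ⟪u, n⟫ * ENNReal.ofReal (exp (-(s / γ ^ 2) * ‖n‖ ^ 2))) := by
      rw [lintegral_lintegral_swap]
      simp only [Function.uncurry_def]
      fun_prop
    _ = ENNReal.ofReal K * ∫⁻ s in Set.Ioi 0, ∫⁻ y,
          ENNReal.ofReal ((π * γ ^ 2) ^ ((k : ℝ) / 2)) *
          (g y * ENNReal.ofReal (exp (-((1 + y ^ 2 / γ ^ 2) * s)))) := by
      congr 1
      refine setLIntegral_congr_fun measurableSet_Ioi fun s hs => ?_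
      have hs : 0 < s := hs
      rw [lintegral_const_mul' _ _ ENNReal.ofReal_ne_top,
        lintegral_gaussian_inner hu (by positivity) hg, ← mul_assoc,
        ← ENNReal.ofReal_mul (by positivity), ← lintegral_const_mul' _ _ ENNReal.ofReal_ne_top]
      refine lintegral_congr fun y => ?_
      rw [mul_left_comm, ← ENNReal.ofReal_mul (by positivity), mul_left_comm (ENNReal.ofReal _),
        ← ENNReal.ofReal_mul (by positivity)]
      congr 2
      rw [show -((1 + y ^ 2 / γ ^ 2) * s) = -s + -(s / γ ^ 2) * y ^ 2 by ring, exp_add,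
        show π / (s / γ ^ 2) = (π * γ ^ 2) / s by field_simp,
        div_rpow (by positivity) hs.le]
      have : 0 < s ^ ((k : ℝ) / 2) := by positivity
      field_simp
    _ = ENNReal.ofReal K * ∫⁻ y, ∫⁻ s in Set.Ioi 0,
          ENNReal.ofReal ((π * γ ^ 2) ^ ((k : ℝ) / 2)) *
          (g y * ENNReal.ofReal (exp (-((1 + y ^ 2 / γ ^ 2) * s)))) := by
      rw [lintegral_lintegral_swap]
      simp only [Function.uncurry_def]
      fun_prop
    _ = _ := by
      rw [← lintegral_const_mul' _ _ ENNReal.ofReal_ne_top]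
      refine lintegral_congr fun y => ?_
      have hy : 0 < 1 + y ^ 2 / γ ^ 2 := by positivity
      have h := lintegral_rpow_mul_exp_neg_mul_Ioi one_pos hy
      simp only [sub_self, rpow_zero, one_mul, rpow_one, Gamma_one, mul_one, one_div] at h
      rw [lintegral_const_mul _ (by fun_prop), lintegral_const_mul _ (by fun_prop), h,
        ← mul_assoc, ← ENNReal.ofReal_mul (by positivity), mul_left_comm,
        ← ENNReal.ofReal_mul (by positivity)]
      congr 3
      rw [hK, mul_rpow pi_pos.le (by positivity), ← rpow_natCast γ 2, ← rpow_mul hγ.le,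
        mul_mul_mul_comm, ← rpow_add pi_pos, ← rpow_add hγ]
      rw [show -((k : ℝ) / 2 + 1) + k / 2 = -1 by ring,
        show -((k : ℝ) + 1) + ((2 : ℕ) : ℝ) * (k / 2) = -1 by push_cast; ring,
        rpow_neg_one, rpow_neg_one, mul_inv]

theorem lintegral_cauchy_Ioi {γ : ℝ} (hγ : 0 < γ) (t : ℝ) :
    ∫⁻ y in Set.Ioi t, ENNReal.ofReal ((π * γ)⁻¹ * (1 + y ^ 2 / γ ^ 2)⁻¹)
      = ENNReal.ofReal (1 / 2 - 1 / π * arctan (t / γ)) := by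
  have hd : ∀ y ∈ Set.Ici t, HasDerivAt (fun y => 1 / π * arctan (y / γ))
      ((π * γ)⁻¹ * (1 + y ^ 2 / γ ^ 2)⁻¹) y := by
    intro y _
    convert! (((hasDerivAt_id y).div_const γ).arctan).const_mul (1 / π) using 1
    simp only [id, div_pow]
    field_simp
  have hp : ∀ y ∈ Set.Ioi t, 0 ≤ (π * γ)⁻¹ * (1 + y ^ 2 / γ ^ 2)⁻¹ := fun y _ => by positivity
  have hl : Tendsto (fun y => 1 / π * arctan (y / γ)) atTop (𝓝 (1 / 2)) := by
    have := ((tendsto_nhds_of_tendsto_nhdsWithin tendsto_arctan_atTop).comp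
      (tendsto_id.atTop_div_const hγ)).const_mul (1 / π)
    convert! this using 2
    field_simp
  rw [← integral_Ioi_of_hasDerivAt_of_nonneg' hd hp hl,
    ofReal_integral_eq_lintegral_ofReal (integrableOn_Ioi_deriv_of_nonneg' hd hp hl)
      ((ae_restrict_iff' measurableSet_Ioi).2 (ae_of_all _ hp))]

theorem setLIntegral_fC_halfSpace {k : ℕ} {γ : ℝ} (hγ : 0 < γ)
    {v : EuclideanSpace ℝ (Fin (k + 1))} (hv : v ≠ 0) :
    ∫⁻ n in {n | ‖n - v‖ < ‖n‖}, ENNReal.ofReal (fC (k + 1) γ n)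
      = ENNReal.ofReal (1 / 2 - 1 / π * arctan (‖v‖ / (2 * γ))) := by
  have hv' : 0 < ‖v‖ := norm_pos_iff.2 hv
  have hu : ‖‖v‖⁻¹ • v‖ = 1 := by simp [norm_smul, hv'.ne']
  have hg : Measurable ((Set.Ioi (‖v‖ / 2)).indicator (1 : ℝ → ENNReal)) :=
    measurable_one.indicator measurableSet_Ioi
  have h := lintegral_fC_inner hγ hu hg
  have hS : MeasurableSet {n : EuclideanSpace ℝ (Fin (k + 1)) | ‖n - v‖ < ‖n‖} :=
    measurableSet_lt (by fun_prop) (by fun_prop)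
  have harg : ‖v‖ / (2 * γ) = ‖v‖ / 2 / γ := by rw [div_div]
  rw [harg, ← lintegral_cauchy_Ioi hγ, ← lintegral_indicator hS,
    ← lintegral_indicator measurableSet_Ioi]
  refine Eq.trans (lintegral_congr fun n => ?_) (h.trans (lintegral_congr fun y => ?_))
  · have hiff : ‖n - v‖ < ‖n‖ ↔ ‖v‖ / 2 < ⟪‖v‖⁻¹ • v, n⟫ := by
      rw [← sq_lt_sq₀ (norm_nonneg _) (norm_nonneg _), norm_sub_sq_real, real_inner_smul_left,
        real_inner_comm, inv_mul_eq_div, lt_div_iff₀ hv']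
      constructor <;> intro _ <;> nlinarith
    by_cases hn : ‖n - v‖ < ‖n‖
    · simp [hn, hiff.1 hn]
    · have := mt hiff.2 hn
      simp [hn, this]
  · by_cases hy : ‖v‖ / 2 < y <;> simp [hy]

theorem stmt4 (d : ℕ) [DecidableEq (EuclideanSpace ℝ (Fin d))] (hd : 1 ≤ d) (C : Finset (EuclideanSpace ℝ (Fin d)))
    (x : EuclideanSpace ℝ (Fin d)) (hx : x ∈ C) (γ : ℝ) (hγ : 0 < γ) :
    Pe (C : Set (EuclideanSpace ℝ (Fin d))) x γ
      ≤ ∑ c ∈ C.erase x, (1 / 2 - (1 / π) * Real.arctan (‖x - c‖ / (2 * γ))) := by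
  obtain ⟨k, rfl⟩ : ∃ k, d = k + 1 := ⟨d - 1, by omega⟩
  have hterm : ∀ c, 0 ≤ 1 / 2 - 1 / π * arctan (‖x - c‖ / (2 * γ)) := fun c => by
    have := (arctan_lt_pi_div_two (‖x - c‖ / (2 * γ))).le
    have h2 : 1 / π * arctan (‖x - c‖ / (2 * γ)) ≤ 1 / π * (π / 2) := by gcongr
    have h3 : 1 / π * (π / 2) = 1 / 2 := by field_simp
    linarith
  have hf0 : ∀ n, 0 ≤ fC (k + 1) γ n := fun n => by
    have : 0 < Gamma ((((k + 1 : ℕ) : ℝ) + 1) / 2) := Gamma_pos_of_pos (by positivity)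
    unfold fC cC
    positivity
  have hfm : Measurable (fC (k + 1) γ) := by unfold fC; fun_prop
  have hsub : (vorT (C : Set (EuclideanSpace ℝ (Fin (k + 1)))) x)ᶜ ⊆
      ⋃ c ∈ C.erase x, {n | ‖n - (c - x)‖ < ‖n‖} := by
    intro n hn
    by_contra! hcon
    refine hn ⟨n + x, fun c hc => ?_, by simp⟩
    by_cases hcx : c = x
    · rw [hcx]
    · simp only [Set.mem_iUnion, not_exists] at hcon
      have : ‖n‖ ≤ ‖n - (c - x)‖ := not_lt.1 (hcon c (Finset.mem_erase.2 ⟨hcx, hc⟩))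
      rwa [add_sub_cancel_right, show n + x - c = n - (c - x) by abel]
  rw [Pe, integral_eq_lintegral_of_nonneg_ae (ae_of_all _ hf0) hfm.aestronglyMeasurable]
  refine ENNReal.toReal_le_of_le_ofReal (Finset.sum_nonneg fun c _ => hterm c) ?_
  rw [ENNReal.ofReal_sum_of_nonneg fun c _ => hterm c]
  have hm : ∀ c, MeasurableSet {n : EuclideanSpace ℝ (Fin (k + 1)) | ‖n - (c - x)‖ < ‖n‖} :=
    fun c => measurableSet_lt (by fun_prop) (by fun_prop)
  calc
    _ ≤ ∫⁻ n in ⋃ c ∈ C.erase x, {n | ‖n - (c - x)‖ < ‖n‖}, ENNReal.ofReal (fC (k + 1) γ n) :=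
      lintegral_mono_set hsub
    _ ≤ ∑ c ∈ C.erase x, ∫⁻ n in {n | ‖n - (c - x)‖ < ‖n‖}, ENNReal.ofReal (fC (k + 1) γ n) := by
      rw [← withDensity_apply _ (Finset.measurableSet_biUnion _ fun c _ => hm c)]
      simp_rw [← withDensity_apply _ (hm _)]
      exact measure_biUnion_finset_le _ _
    _ ≤ _ := Finset.sum_le_sum fun c hc => by
      rw [setLIntegral_fC_halfSpace hγ (sub_ne_zero.2 (Finset.ne_of_mem_erase hc)), norm_sub_rev]
end

section
/- Let C = {x_1, …, x_M} ⊂ ℝ^d be a finite set of M distinct points. Then the average correct-decision probability converges as γ → ∞ to the average isotropic Cauchy mass of the Voronoi recession cones: lim_{γ → ∞} (1/M)·Σ_{i=1}^M ∫_{V(x_i) − x_i} f_γ(n) dn = (1/M)·Σ_{i=1}^M ∫_{K(x_i)} c_d · (1 + ‖u‖²)^{−(d+1)/2} du. -/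
open MeasureTheory Real Filter
open scoped RealInnerProductSpace Topology

/-- The recession cone of the Voronoi cell of `x`. -/
def recCone {d : ℕ} (C : Set (EuclideanSpace ℝ (Fin d))) (x : EuclideanSpace ℝ (Fin d)) :
    Set (EuclideanSpace ℝ (Fin d)) := {u | ∀ c ∈ C, ⟪u, c - x⟫ ≤ 0}

/-- Correct-decision probability `P_c(x;γ)`. -/
noncomputable def Pc {d : ℕ} (C : Set (EuclideanSpace ℝ (Fin d)))
    (x : EuclideanSpace ℝ (Fin d)) (γ : ℝ) : ℝ :=
  ∫ n in vorT C x, fC d γ n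

theorem mem_vorT_iff {d : ℕ} (C : Set (EuclideanSpace ℝ (Fin d)))
    (x n : EuclideanSpace ℝ (Fin d)) :
    n ∈ vorT C x ↔ ∀ c ∈ C, 2 * ⟪n, c - x⟫ ≤ ‖c - x‖ ^ 2 := by
  have key : ∀ c, ‖n + x - x‖ ≤ ‖n + x - c‖ ↔ 2 * ⟪n, c - x⟫ ≤ ‖c - x‖ ^ 2 := by
    intro c
    rw [show n + x - x = n by abel, show n + x - c = n - (c - x) by abel,
      ← sq_le_sq₀ (norm_nonneg _) (norm_nonneg _), norm_sub_sq_real]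
    constructor <;> intro h <;> linarith
  constructor
  · rintro ⟨y, hy, rfl⟩ c hc
    rw [← key c, sub_add_cancel]
    exact hy c hc
  · intro h
    exact ⟨n + x, fun c hc => (key c).2 (h c hc), by simp⟩

theorem smul_mem_vorT_iff {d : ℕ} (C : Set (EuclideanSpace ℝ (Fin d)))
    (x u : EuclideanSpace ℝ (Fin d)) (γ : ℝ) :
    γ • u ∈ vorT C x ↔ ∀ c ∈ C, 2 * (γ * ⟪u, c - x⟫) ≤ ‖c - x‖ ^ 2 := by
  simp only [mem_vorT_iff, real_inner_smul_left]

theorem isClosed_vorT {d : ℕ} (C : Set (EuclideanSpace ℝ (Fin d)))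
    (x : EuclideanSpace ℝ (Fin d)) : IsClosed (vorT C x) := by
  have h : vorT C x = ⋂ c ∈ C, {n | 2 * ⟪n, c - x⟫ ≤ ‖c - x‖ ^ 2} := by
    ext n
    simp [mem_vorT_iff]
  rw [h]
  exact isClosed_biInter fun c _ => isClosed_le (by fun_prop) continuous_const

theorem isClosed_recCone {d : ℕ} (C : Set (EuclideanSpace ℝ (Fin d)))
    (x : EuclideanSpace ℝ (Fin d)) : IsClosed (recCone C x) := by
  have h : recCone C x = ⋂ c ∈ C, {u | ⟪u, c - x⟫ ≤ 0} := by
    ext n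
    simp [recCone]
  rw [h]
  exact isClosed_biInter fun c _ => isClosed_le (by fun_prop) continuous_const

theorem smul_mem_vorT_of_mem_recCone {d : ℕ} {C : Set (EuclideanSpace ℝ (Fin d))}
    {x u : EuclideanSpace ℝ (Fin d)} (hu : u ∈ recCone C x) {γ : ℝ} (hγ : 0 ≤ γ) :
    γ • u ∈ vorT C x := by
  rw [smul_mem_vorT_iff]
  intro c hc
  nlinarith [mul_nonpos_of_nonneg_of_nonpos hγ (hu c hc), sq_nonneg ‖c - x‖]

theorem eventually_smul_notMem_vorT {d : ℕ} {C : Set (EuclideanSpace ℝ (Fin d))}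
    {x u : EuclideanSpace ℝ (Fin d)} (hu : u ∉ recCone C x) :
    ∀ᶠ γ : ℝ in atTop, γ • u ∉ vorT C x := by
  simp only [recCone, Set.mem_ofPred_eq, not_forall, not_le] at hu
  obtain ⟨c, hc, hpos⟩ := hu
  have ht : Tendsto (fun γ : ℝ => 2 * (γ * ⟪u, c - x⟫)) atTop atTop :=
    (tendsto_id.atTop_mul_const hpos).const_mul_atTop two_pos
  filter_upwards [ht.eventually_gt_atTop (‖c - x‖ ^ 2)] with γ hγ hmem
  exact absurd ((smul_mem_vorT_iff C x u γ).1 hmem c hc) (not_le.2 hγ)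

theorem integrable_unit_cauchy (d : ℕ) :
    Integrable fun u : EuclideanSpace ℝ (Fin d) =>
      cC d * (1 + ‖u‖ ^ 2) ^ (-(((d : ℝ) + 1) / 2)) := by
  have h := integrable_rpow_neg_one_add_norm_sq (E := EuclideanSpace ℝ (Fin d))
    (μ := volume) (r := (d : ℝ) + 1) (by simp)
  simpa only [neg_div] using h.const_mul (cC d)

theorem fC_smul {d : ℕ} {γ : ℝ} (hγ : 0 < γ) (u : EuclideanSpace ℝ (Fin d)) :
    fC d γ (γ • u) = (γ ^ d)⁻¹ * (cC d * (1 + ‖u‖ ^ 2) ^ (-(((d : ℝ) + 1) / 2))) := by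
  have h : ‖γ • u‖ ^ 2 / γ ^ 2 = ‖u‖ ^ 2 := by
    rw [norm_smul, mul_pow, Real.norm_of_nonneg hγ.le]
    field_simp
  rw [fC, h, Real.rpow_neg hγ.le, Real.rpow_natCast]
  ring

theorem Pc_eq_integral_indicator {d : ℕ} (C : Set (EuclideanSpace ℝ (Fin d)))
    (x : EuclideanSpace ℝ (Fin d)) {γ : ℝ} (hγ : 0 < γ) :
    Pc C x γ = ∫ u, ((γ • ·) ⁻¹' vorT C x).indicator
      (fun u => cC d * (1 + ‖u‖ ^ 2) ^ (-(((d : ℝ) + 1) / 2))) u := by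
  have hne : γ ^ d ≠ 0 := (pow_pos hγ d).ne'
  have hscale := Measure.integral_comp_smul_of_nonneg volume
    ((vorT C x).indicator (fC d γ)) γ (hR := hγ.le)
  rw [finrank_euclideanSpace_fin, integral_indicator (isClosed_vorT C x).measurableSet,
    smul_eq_mul] at hscale
  rw [Pc, ← mul_right_inj' (inv_ne_zero hne), ← hscale, ← integral_const_mul]
  congr 1 with u
  by_cases hu : γ • u ∈ vorT C x
  · rw [Set.indicator_of_mem hu, Set.indicator_of_mem (by exact hu), fC_smul hγ]
  · rw [Set.indicator_of_notMem hu, Set.indicator_of_notMem (by exact hu), mul_zero]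

theorem tendsto_Pc_atTop {d : ℕ} (C : Set (EuclideanSpace ℝ (Fin d)))
    (x : EuclideanSpace ℝ (Fin d)) :
    Tendsto (Pc C x) atTop
      (𝓝 (∫ u in recCone C x, cC d * (1 + ‖u‖ ^ 2) ^ (-(((d : ℝ) + 1) / 2)))) := by
  have hint := integrable_unit_cauchy d
  rw [← integral_indicator (isClosed_recCone C x).measurableSet]
  refine Tendsto.congr' (f₁ := fun γ : ℝ => ∫ u, ((γ • ·) ⁻¹' vorT C x).indicator
      (fun u => cC d * (1 + ‖u‖ ^ 2) ^ (-(((d : ℝ) + 1) / 2))) u) ?_ ?_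
  · filter_upwards [eventually_gt_atTop 0] with γ hγ
    exact (Pc_eq_integral_indicator C x hγ).symm
  refine tendsto_integral_filter_of_dominated_convergence _ ?_ ?_ hint.norm ?_
  · refine Eventually.of_forall fun γ => hint.aestronglyMeasurable.indicator ?_
    exact ((isClosed_vorT C x).preimage (continuous_const_smul γ)).measurableSet
  · exact Eventually.of_forall fun γ => Eventually.of_forall fun u =>
      norm_indicator_le_norm_self _ u
  · refine Eventually.of_forall fun u => tendsto_const_nhds.congr' ?_
    by_cases hu : u ∈ recCone C x
    · filter_upwards [eventually_ge_atTop 0] with γ hγ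
      rw [Set.indicator_of_mem hu,
        Set.indicator_of_mem (by exact smul_mem_vorT_of_mem_recCone hu hγ)]
    · filter_upwards [eventually_smul_notMem_vorT hu] with γ hγ
      rw [Set.indicator_of_notMem hu, Set.indicator_of_notMem (by exact hγ)]

theorem stmt11 (d M : ℕ) (hd : 1 ≤ d) (hM : 1 ≤ M)
    (x : Fin M → EuclideanSpace ℝ (Fin d)) (hx : Function.Injective x) :
    Tendsto (fun γ : ℝ => (1 / (M : ℝ)) * ∑ i : Fin M, Pc (Set.range x) (x i) γ) atTop
      (nhds ((1 / (M : ℝ)) * ∑ i : Fin M,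
        ∫ u in recCone (Set.range x) (x i),
          cC d * (1 + ‖u‖ ^ 2) ^ (-(((d : ℝ) + 1) / 2)))) := by
  exact (tendsto_finsetSum _ fun i _ => tendsto_Pc_atTop (Set.range x) (x i)).const_mul _
end
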